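/- Let φ : [0,∞] → [0,∞] be a non-decreasing function such that φ(t) ≥ C·t for all t ∈ [T,∞] for some C > 0 and T ∈ (0,∞), and such that ∫_{δ*}^{∞} dτ/(τ·φ⁻¹(τ)) < ∞ for some δ* ∈ (φ(0), ∞). Then for every n ≥ 2 there exist R > 1 and a C¹ diffeomorphism f of the punctured unit ball 𝔹ⁿ \ {0} onto the spherical ring { x ∈ ℝⁿ : 1 < |x| < R } such that ∫_{𝔹ⁿ\{0}} φ(K_O(x,f)) dm(x) < ∞, but f cannot be extended by continuity to 0, i.e. the limit of f(x) as x → 0 does not exist. -/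

import Mathlib

open MeasureTheory Metric Set Filter
open scoped ENNReal NNReal Topology

/-- The generalized inverse `φ⁻¹(τ) = inf{ t : φ(t) ≥ τ }` of a non-decreasing
function `φ : [0,∞] → [0,∞]` (with `inf ∅ = ∞`). -/
noncomputable def genInv (φ : ℝ≥0∞ → ℝ≥0∞) (τ : ℝ≥0∞) : ℝ≥0∞ :=
  sInf {t : ℝ≥0∞ | τ ≤ φ t}

/-- An antitonepositive function `g ≤ 1` integrable at `+∞` has a continuous majorant
`lam ≤ 1` which is minus the derivative of a function vanishing at `+∞`. -/
theorem exists_primitive_of_antitone {g : ℝ → ℝ} (hg : Antitone g) (hpos : ∀ u, 0 < g u)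
    (hle : ∀ u, g u ≤ 1) (hint : IntegrableOn g (Ioi 0)) :
    ∃ E lam : ℝ → ℝ, Continuous lam ∧ (∀ u, HasDerivAt E (-lam u) u) ∧
      (∀ u, g u ≤ lam u) ∧ (∀ u, lam u ≤ 1) ∧ Tendsto E atTop (𝓝 0) := by
  have hii : ∀ a b, IntervalIntegrable g volume a b := fun a b => hg.intervalIntegrable
  set F : ℝ → ℝ := fun u => (∫ t in Ioi 0, g t) - ∫ t in (0 : ℝ)..u, g t with hF
  have hFc : Continuous F :=
    continuous_const.sub (intervalIntegral.continuous_primitive hii 0)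
  have hFsub : ∀ a b, F a - F b = ∫ t in a..b, g t := fun a b => by
    rw [← intervalIntegral.integral_interval_sub_left (hii 0 b) (hii 0 a)]
    simp only [hF]; ring
  have hFanti : Antitone F := fun a b hab => by
    have : 0 ≤ ∫ t in a..b, g t :=
      intervalIntegral.integral_nonneg hab fun t _ => (hpos t).le
    linarith [hFsub a b]
  have hF0 : Tendsto F atTop (𝓝 0) := by
    simpa using (intervalIntegral_tendsto_integral_Ioi 0 hint tendsto_id).const_sub
      (∫ t in Ioi 0, g t)
  have hFi : ∀ a b, IntervalIntegrable F volume a b := fun a b => hFc.intervalIntegrable a b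
  have hΦ : ∀ u, HasDerivAt (fun u => ∫ t in (0 : ℝ)..u, F t) (F u) u :=
    fun u => hFc.integral_hasStrictDerivAt 0 u |>.hasDerivAt
  have hE : ∀ u, (∫ t in (0 : ℝ)..u, F t) - (∫ t in (0 : ℝ)..(u - 1), F t)
      = ∫ t in (u - 1)..u, F t := fun u =>
    intervalIntegral.integral_interval_sub_left (hFi _ _) (hFi _ _)
  refine ⟨fun u => (∫ t in (0 : ℝ)..u, F t) - ∫ t in (0 : ℝ)..(u - 1), F t,
    fun u => F (u - 1) - F u, by fun_prop, fun u => ?_, fun u => ?_, fun u => ?_, ?_⟩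
  · rw [neg_sub]
    exact (hΦ u).sub (by simpa using (hΦ (u - 1)).comp_sub_const u 1)
  · simp only [hFsub]
    have := intervalIntegral.integral_mono_on (by linarith : u - 1 ≤ u)
      (intervalIntegrable_const (c := g u)) (hii (u - 1) u) fun t ht => hg ht.2
    simpa using this
  · simp only [hFsub]
    have := intervalIntegral.integral_mono_on (by linarith : u - 1 ≤ u)
      (hii (u - 1) u) (intervalIntegrable_const (c := 1)) fun t _ => hle t
    simpa using this
  · simp only [hE]
    refine tendsto_of_tendsto_of_tendsto_of_le_of_le hF0
      (hF0.comp (tendsto_atTop_add_const_right _ (-1) tendsto_id)) (fun u => ?_) fun u => ?_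
    · have := intervalIntegral.integral_mono_on (by linarith : u - 1 ≤ u)
        (intervalIntegrable_const (c := F u)) (hFi (u - 1) u) fun t ht => hFanti ht.2
      simpa using this
    · have := intervalIntegral.integral_mono_on (by linarith : u - 1 ≤ u)
        (hFi (u - 1) u) (intervalIntegrable_const (c := F (u - 1))) fun t ht => hFanti ht.1
      simpa [← sub_eq_add_neg] using this

/-- The inverse of an injective `C¹` map with nondegenerate derivative on an open set is `C¹`. -/
theorem contDiffOn_invFunOn {E : Type*} [NormedAddCommGroup E] [NormedSpace ℝ E]
    [FiniteDimensional ℝ E] {f : E → E} {s : Set E} (hs : IsOpen s) (hinj : InjOn f s)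
    (hf : ContDiffOn ℝ 1 f s) (hdet : ∀ x ∈ s, (fderiv ℝ f x).det ≠ 0) :
    ContDiffOn ℝ 1 (Function.invFunOn f s) (f '' s) := by
  have : CompleteSpace E := FiniteDimensional.complete ℝ E
  rintro _ ⟨x, hx, rfl⟩
  have hfx : ContDiffAt ℝ 1 f x := hf.contDiffAt (hs.mem_nhds hx)
  have hd : HasFDerivAt f
      ((fderiv ℝ f x).toContinuousLinearEquivOfDetNeZero (hdet x hx) : E →L[ℝ] E) x := by
    simpa using (hfx.differentiableAt one_ne_zero).hasFDerivAt
  have hinv := hfx.to_localInverse hd one_ne_zero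
  have hmem : ∀ᶠ y in 𝓝 (f x), hfx.localInverse hd one_ne_zero y ∈ s := by
    refine hinv.continuousAt.eventually_mem (hs.mem_nhds ?_)
    rwa [hfx.localInverse_apply_image]
  refine (hinv.congr_of_eventuallyEq ?_).contDiffWithinAt
  filter_upwards [hmem, (hfx.hasStrictFDerivAt' hd one_ne_zero).eventually_right_inverse]
    with y hy hfy
  have := hinj.leftInvOn_invFunOn hy
  rwa [show f (hfx.localInverse hd one_ne_zero y) = y from hfy] at this

/-- The reciprocal of the norm is integrable on the unit ball in dimension at least two. -/
theorem lintegral_ball_inv_norm_ne_top {E : Type*} [NormedAddCommGroup E] [NormedSpace ℝ E]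
    [FiniteDimensional ℝ E] [MeasurableSpace E] [BorelSpace E] (μ : Measure E)
    [μ.IsAddHaarMeasure] (hE : 2 ≤ Module.finrank ℝ E) :
    ∫⁻ x in ball (0 : E) 1, ENNReal.ofReal ‖x‖⁻¹ ∂μ ≠ ∞ := by
  have : Nontrivial E := Module.nontrivial_of_finrank_pos (R := ℝ) (by omega)
  have h : IntegrableOn (fun x : E => ‖x‖⁻¹) (ball 0 1) μ := by
    rw [integrableOn_fun_norm_addHaar μ (f := fun r => r⁻¹)]
    obtain ⟨k, hk⟩ := Nat.exists_eq_add_of_le hE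
    have hc : IntegrableOn (fun y : ℝ => y ^ k) (Ioo 0 1) :=
      (Continuous.integrableOn_Icc (by fun_prop)).mono_set Ioo_subset_Icc_self
    refine hc.congr_fun (fun y hy => ?_) measurableSet_Ioo
    have : y ≠ 0 := hy.1.ne'
    rw [hk, show 2 + k - 1 = k + 1 by omega]
    simp [pow_succ, this]
  have := h.hasFiniteIntegral
  rw [hasFiniteIntegral_iff_norm] at this
  simpa using this.ne

section Radial

variable {V : Type*} [NormedAddCommGroup V] [InnerProductSpace ℝ V]

/-- The radial map which, in the coordinate `u = -log ‖x‖`, sends the sphere of radius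
`exp (-u)` onto the sphere of radius `exp (E u)`. -/
noncomputable def radialMap (E : ℝ → ℝ) (x : V) : V :=
  Real.exp (E (-Real.log ‖x‖) - Real.log ‖x‖) • x

/-- The linear map acting as the scalar `l` on the line through `x` and as the identity on its
orthogonal complement. -/
noncomputable def lineStretch (l : ℝ) (x : V) : V →L[ℝ] V :=
  ContinuousLinearMap.id ℝ V + ((l - 1) / ‖x‖ ^ 2) • (innerSL ℝ x).smulRight x

theorem norm_lineStretch_le {l : ℝ} (h0 : 0 ≤ l) (h1 : l ≤ 1) (x : V) :
    ‖lineStretch l x‖ ≤ 1 := by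
  refine ContinuousLinearMap.opNorm_le_bound _ zero_le_one fun v => ?_
  rw [one_mul]
  rcases eq_or_ne x 0 with rfl | hx
  · simp [lineStretch]
  have hx2 : 0 < ‖x‖ ^ 2 := by positivity
  refine le_of_sq_le_sq ?_ (norm_nonneg v)
  have : lineStretch l x v = v + ((l - 1) / ‖x‖ ^ 2 * inner ℝ x v) • x := by
    simp [lineStretch, smul_smul]
  rw [this, norm_add_sq_real, inner_smul_right, norm_smul, mul_pow, Real.norm_eq_abs, sq_abs,
    real_inner_comm x v]
  have key : 2 * ((l - 1) / ‖x‖ ^ 2 * inner ℝ x v * inner ℝ x v)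
      + ((l - 1) / ‖x‖ ^ 2 * inner ℝ x v) ^ 2 * ‖x‖ ^ 2
      = (l - 1) * (l + 1) * (inner ℝ x v) ^ 2 / ‖x‖ ^ 2 := by
    field_simp
    ring
  have : (l - 1) * (l + 1) * (inner ℝ x v) ^ 2 / ‖x‖ ^ 2 ≤ 0 := by
    apply div_nonpos_of_nonpos_of_nonneg _ hx2.le
    exact mul_nonpos_of_nonpos_of_nonneg (by nlinarith) (sq_nonneg _)
  linarith

theorem det_lineStretch [FiniteDimensional ℝ V] (l : ℝ) {x : V} (hx : x ≠ 0) :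
    (lineStretch l x).det = l := by
  have hx2 : ‖x‖ ^ 2 ≠ 0 := by positivity
  have : (lineStretch l x : V →ₗ[ℝ] V)
      = LinearMap.transvection (((l - 1) / ‖x‖ ^ 2) • (innerSL ℝ x : V →ₗ[ℝ] ℝ)) x := by
    ext v
    simp [lineStretch, LinearMap.transvection.apply, smul_smul]
  rw [ContinuousLinearMap.det, this, LinearMap.transvection.det]
  simp [hx2]

theorem det_smul_lineStretch [FiniteDimensional ℝ V] (a l : ℝ) {x : V} (hx : x ≠ 0) :
    (a • lineStretch l x).det = a ^ Module.finrank ℝ V * l := by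
  refine (LinearMap.det_smul a (lineStretch l x : V →ₗ[ℝ] V)).trans ?_
  rw [← ContinuousLinearMap.det, det_lineStretch l hx]

variable {E lam : ℝ → ℝ}

theorem norm_radialMap {x : V} (hx : x ≠ 0) :
    ‖radialMap E x‖ = Real.exp (E (-Real.log ‖x‖)) := by
  have : 0 < ‖x‖ := norm_pos_iff.2 hx
  rw [radialMap, norm_smul, Real.norm_eq_abs, Real.abs_exp, Real.exp_sub, Real.exp_log this]
  field_simp

theorem radialMap_neg (x : V) : radialMap E (-x) = -radialMap E x := by
  simp [radialMap]

theorem contDiffAt_radialMap (hE : ContDiff ℝ 1 E) {x : V} (hx : x ≠ 0) :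
    ContDiffAt ℝ 1 (radialMap E) x := by
  have hn : ‖x‖ ≠ 0 := norm_ne_zero_iff.2 hx
  have hlog : ContDiffAt ℝ 1 (fun x : V => Real.log ‖x‖) x := (contDiffAt_norm ℝ hx).log hn
  exact ((hE.contDiffAt.comp x hlog.neg).sub hlog).exp.smul contDiffAt_id

theorem hasFDerivAt_radialMap (hE : ∀ u, HasDerivAt E (-lam u) u) {x : V} (hx : x ≠ 0) :
    HasFDerivAt (radialMap E)
      (Real.exp (E (-Real.log ‖x‖) - Real.log ‖x‖) • lineStretch (lam (-Real.log ‖x‖)) x) x := by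
  have hn : ‖x‖ ≠ 0 := norm_ne_zero_iff.2 hx
  have hlog : HasFDerivAt (fun x : V => Real.log ‖x‖) ((‖x‖ ^ 2)⁻¹ • innerSL ℝ x) x := by
    have h := ((hasStrictFDerivAt_norm_sq x).hasFDerivAt.log (by positivity)).const_mul (1 / 2)
    refine (h.congr_fderiv ?_).congr_of_eventuallyEq (Eventually.of_forall fun y => ?_)
    · ext v
      simp
      ring
    · simp [Real.log_pow]
  have hlam := ((hE _).comp_hasFDerivAt x hlog.neg).sub hlog
  refine (hlam.exp.smul (hasFDerivAt_id x)).congr_fderiv ?_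
  ext1 v
  simp [lineStretch, smul_smul, sub_eq_add_neg]
  ring_nf

theorem injOn_radialMap (hE : StrictAnti E) : InjOn (radialMap E) ({0}ᶜ : Set V) := by
  intro x hx y hy hxy
  have hx0 : 0 < ‖x‖ := norm_pos_iff.2 hx
  have hy0 : 0 < ‖y‖ := norm_pos_iff.2 hy
  have h := congrArg norm hxy
  rw [norm_radialMap hx, norm_radialMap hy, Real.exp_eq_exp, hE.injective.eq_iff, neg_inj] at h
  have h' : ‖x‖ = ‖y‖ := Real.log_injOn_pos hx0 hy0 h
  simp only [radialMap, h'] at hxy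
  exact smul_right_injective V (Real.exp_ne_zero _) hxy

theorem image_radialMap (hE : StrictAnti E) (hc : Continuous E) (h0 : Tendsto E atTop (𝓝 0)) :
    radialMap E '' (ball (0 : V) 1 \ {0}) = {y : V | 1 < ‖y‖ ∧ ‖y‖ < Real.exp (E 0)} := by
  have hpos : ∀ u, 0 < E u := fun u =>
    (hE.antitone.le_of_tendsto h0 (u + 1)).trans_lt (hE (lt_add_one u))
  ext y
  constructor
  · rintro ⟨x, ⟨hx1, hx⟩, rfl⟩
    have hx0 : 0 < ‖x‖ := norm_pos_iff.2 hx
    rw [mem_ball_zero_iff] at hx1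
    rw [mem_ofPred_eq, norm_radialMap hx, Real.one_lt_exp_iff, Real.exp_lt_exp]
    exact ⟨hpos _, hE (by linarith [Real.log_neg hx0 hx1])⟩
  · rintro ⟨h1, h2⟩
    have hy0 : 0 < ‖y‖ := by linarith
    have hlog : 0 < Real.log ‖y‖ := Real.log_pos h1
    have hlog2 : Real.log ‖y‖ < E 0 := (Real.log_lt_iff_lt_exp hy0).2 h2
    obtain ⟨v, hv⟩ := (h0.eventually_lt_const hlog).exists
    obtain ⟨u, hu⟩ : Real.log ‖y‖ ∈ range E :=
      mem_range_of_exists_le_of_exists_ge hc ⟨v, hv.le⟩ ⟨0, hlog2.le⟩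
    have hu0 : 0 < u := by
      rw [← hu] at hlog2
      exact hE.lt_iff_gt.1 hlog2
    have hnorm : ‖(Real.exp (-u) / ‖y‖) • y‖ = Real.exp (-u) := by
      rw [norm_smul, Real.norm_eq_abs, abs_of_pos (by positivity)]
      field_simp
    refine ⟨(Real.exp (-u) / ‖y‖) • y, ⟨?_, ?_⟩, ?_⟩
    · rw [mem_ball_zero_iff, hnorm, Real.exp_lt_one_iff]
      linarith
    · rw [mem_singleton_iff, ← norm_eq_zero, hnorm]
      positivity
    · rw [radialMap, hnorm, Real.log_exp, neg_neg, hu, smul_smul, sub_neg_eq_add, Real.exp_add,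
        Real.exp_log hy0, Real.exp_neg]
      convert one_smul ℝ y using 2
      have := Real.exp_pos u
      field_simp

theorem not_tendsto_radialMap [Nontrivial V] (hE : ∀ u, 0 ≤ E u) :
    ¬ ∃ L : V, Tendsto (radialMap E) (𝓝[ball (0 : V) 1 \ {0}] 0) (𝓝 L) := by
  rintro ⟨L, hL⟩
  have heq : 𝓝[ball (0 : V) 1 \ {0}] (0 : V) = 𝓝[≠] 0 := by
    rw [sdiff_eq, inter_comm]
    exact nhdsWithin_inter_of_mem' (mem_nhdsWithin_of_mem_nhds (ball_mem_nhds 0 one_pos))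
  rw [heq] at hL
  have : (𝓝[≠] (0 : V)).NeBot := Module.punctured_nhds_neBot ℝ V 0
  have hneg : Tendsto (fun x : V => -x) (𝓝[≠] 0) (𝓝[≠] 0) := by
    refine tendsto_nhdsWithin_iff.2 ⟨?_, ?_⟩
    · simpa using (continuous_neg.tendsto (0 : V)).mono_left nhdsWithin_le_nhds
    · filter_upwards [self_mem_nhdsWithin] with x hx
      simpa using hx
  have h1 : Tendsto (fun x : V => -radialMap E x) (𝓝[≠] 0) (𝓝 L) := by
    simpa only [Function.comp_def, radialMap_neg] using hL.comp hneg
  have h2 : L = -L := tendsto_nhds_unique h1 hL.neg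
  have h3 : L = 0 := by
    have : (2 : ℝ) • L = 0 := by rw [two_smul, ← eq_neg_iff_add_eq_zero.1 h2]
    simpa using this
  have h4 : 1 ≤ ‖L‖ := by
    refine ge_of_tendsto hL.norm ?_
    filter_upwards [self_mem_nhdsWithin] with x hx
    rw [norm_radialMap hx]
    exact Real.one_le_exp (hE _)
  rw [h3, norm_zero] at h4
  linarith

/-- The outer dilatation of a radial map which contracts in the radial direction. -/
theorem outerDilatation_radialMap_le [FiniteDimensional ℝ V]
    (hE : ∀ u, HasDerivAt E (-lam u) u) (h0 : ∀ u, 0 < lam u) (h1 : ∀ u, lam u ≤ 1)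
    {x : V} (hx : x ≠ 0) :
    ‖fderiv ℝ (radialMap E) x‖ ^ Module.finrank ℝ V / |(fderiv ℝ (radialMap E) x).det|
      ≤ (lam (-Real.log ‖x‖))⁻¹ := by
  rw [(hasFDerivAt_radialMap hE hx).fderiv, det_smul_lineStretch _ _ hx, norm_smul,
    Real.norm_eq_abs, Real.abs_exp]
  set a := Real.exp (E (-Real.log ‖x‖) - Real.log ‖x‖)
  set l := lam (-Real.log ‖x‖)
  have ha : 0 < a := Real.exp_pos _
  have hl : 0 < l := h0 _
  rw [abs_of_pos (by positivity), mul_pow, mul_div_mul_left _ _ (by positivity), ← one_div]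
  gcongr
  exact pow_le_one₀ (norm_nonneg _) (norm_lineStretch_le hl.le (h1 _) x)

end Radial

section Growth

theorem genInv_mono (φ : ℝ≥0∞ → ℝ≥0∞) : Monotone (genInv φ) := fun _ _ h =>
  sInf_le_sInf fun _ ht => h.trans ht

theorem apply_lt_of_lt_genInv {φ : ℝ≥0∞ → ℝ≥0∞} {t τ : ℝ≥0∞} (h : t < genInv φ τ) : φ t < τ :=
  lt_of_not_ge fun h' => (sInf_le (show t ∈ {t | τ ≤ φ t} from h')).not_gt h

theorem genInv_lt_top {φ : ℝ≥0∞ → ℝ≥0∞} {C T : ℝ} (hC : 0 < C)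
    (hgrowth : ∀ t : ℝ≥0∞, ENNReal.ofReal T ≤ t → ENNReal.ofReal C * t ≤ φ t)
    {τ : ℝ≥0∞} (hτ : τ ≠ ∞) : genInv φ τ < ∞ := by
  have hC0 : ENNReal.ofReal C ≠ 0 := by simpa using hC
  refine (sInf_le (show max (ENNReal.ofReal T) (τ / ENNReal.ofReal C) ∈ {t | τ ≤ φ t} from
    ?_)).trans_lt (max_lt ENNReal.ofReal_lt_top (ENNReal.div_lt_top hτ hC0))
  refine le_trans ?_ (hgrowth _ (le_max_left _ _))
  calc τ = ENNReal.ofReal C * (τ / ENNReal.ofReal C) :=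
        (ENNReal.mul_div_cancel hC0 ENNReal.ofReal_ne_top).symm
    _ ≤ _ := by gcongr; exact le_max_right _ _

/-- Logarithmic change of variables. -/
theorem lintegral_Ioi_inv_mul {c : ℝ} (hc : 0 < c) (ψ : ℝ≥0∞ → ℝ≥0∞) :
    ∫⁻ τ in Ioi c, (ENNReal.ofReal τ * ψ (ENNReal.ofReal τ))⁻¹
      = ∫⁻ u in Ioi (0 : ℝ), (ψ (ENNReal.ofReal (c * Real.exp u)))⁻¹ := by
  have himg : (fun u => c * Real.exp u) '' Ioi 0 = Ioi c := by
    ext τ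
    constructor
    · rintro ⟨u, hu, rfl⟩
      exact lt_mul_of_one_lt_right hc (Real.one_lt_exp_iff.2 hu)
    · intro hτ
      have h1 : 1 < τ / c := (one_lt_div hc).2 hτ
      refine ⟨Real.log (τ / c), Real.log_pos h1, ?_⟩
      simp only [Real.exp_log (zero_lt_one.trans h1)]
      field_simp
  rw [← himg, lintegral_image_eq_lintegral_abs_deriv_mul measurableSet_Ioi
    (fun u _ => ((Real.hasDerivAt_exp u).const_mul c).hasDerivWithinAt)
    (fun u _ v _ h => Real.exp_injective (mul_left_cancel₀ hc.ne' h))]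
  refine lintegral_congr fun u => ?_
  have hpos : 0 < c * Real.exp u := by positivity
  have h0 : ENNReal.ofReal (c * Real.exp u) ≠ 0 := by simpa using hpos
  rw [abs_of_pos hpos, ENNReal.mul_inv (Or.inl h0) (Or.inl ENNReal.ofReal_ne_top), ← mul_assoc,
    ENNReal.mul_inv_cancel h0 ENNReal.ofReal_ne_top, one_mul]

/-- Convergence of the integral of `1 / (τ φ⁻¹(τ))` yields an antitone integrable function `g`
with values in `(0, 1]` such that `φ (1 / g)` grows at most exponentially. -/
theorem exists_antitone_integrable {φ : ℝ≥0∞ → ℝ≥0∞} {C T : ℝ} (hC : 0 < C)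
    (hgrowth : ∀ t : ℝ≥0∞, ENNReal.ofReal T ≤ t → ENNReal.ofReal C * t ≤ φ t)
    {δ : ℝ} (hδ : 0 < δ)
    (hconv : ∫⁻ τ in Ioi δ, (ENNReal.ofReal τ * genInv φ (ENNReal.ofReal τ))⁻¹ ≠ ∞) :
    ∃ (c : ℝ) (g : ℝ → ℝ), 0 < c ∧ Antitone g ∧ (∀ u, 0 < g u) ∧ (∀ u, g u ≤ 1) ∧
      IntegrableOn g (Ioi 0) ∧
      ∀ u, 0 < u → φ (ENNReal.ofReal (g u)⁻¹) ≤ ENNReal.ofReal (c * Real.exp u) := by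
  obtain ⟨c, hδc, hc2⟩ : ∃ c, δ ≤ c ∧ 2 ≤ genInv φ (ENNReal.ofReal c) := by
    by_contra! hlt
    rw [lintegral_Ioi_inv_mul hδ] at hconv
    refine hconv (top_le_iff.1 ?_)
    calc (∞ : ℝ≥0∞) = ∫⁻ _ in Ioi (0 : ℝ), 2⁻¹ := by
          rw [setLIntegral_const, Real.volume_Ioi, ENNReal.mul_top (by simp)]
      _ ≤ _ := by
          refine setLIntegral_mono' measurableSet_Ioi fun u hu => ?_
          exact ENNReal.inv_le_inv.2
            (hlt _ (le_mul_of_one_le_right hδ.le (Real.one_le_exp (le_of_lt hu)))).le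
  have hc : 0 < c := hδ.trans_le hδc
  have hconvc : ∫⁻ u in Ioi (0 : ℝ), (genInv φ (ENNReal.ofReal (c * Real.exp u)))⁻¹ ≠ ∞ := by
    rw [← lintegral_Ioi_inv_mul hc]
    exact ne_top_of_le_ne_top hconv (lintegral_mono_set (Ioi_subset_Ioi hδc))
  set ψ : ℝ → ℝ := fun u => (genInv φ (ENNReal.ofReal (c * Real.exp (max u 0)))).toReal with hψ
  have hfin : ∀ u, genInv φ (ENNReal.ofReal (c * Real.exp (max u 0))) ≠ ∞ := fun u =>
    (genInv_lt_top hC hgrowth ENNReal.ofReal_ne_top).ne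
  have hmono : Monotone ψ := fun u v huv => by
    refine ENNReal.toReal_mono (hfin v) (genInv_mono φ ?_)
    gcongr
  have hψ2 : ∀ u, 2 ≤ ψ u := fun u => by
    refine (ENNReal.ofReal_le_iff_le_toReal (hfin u)).1 ?_
    rw [ENNReal.ofReal_ofNat]
    refine hc2.trans (genInv_mono φ (ENNReal.ofReal_le_ofReal ?_))
    exact le_mul_of_one_le_right hc.le (Real.one_le_exp (le_max_right _ _))
  have hψpos : ∀ u, 0 < ψ u := fun u => two_pos.trans_le (hψ2 u)
  have hanti : Antitone fun u => 2 / ψ u := fun u v huv =>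
    div_le_div_of_nonneg_left two_pos.le (hψpos u) (hmono huv)
  refine ⟨c, fun u => 2 / ψ u, hc, hanti, fun u => div_pos two_pos (hψpos u),
    fun u => (div_le_one (hψpos u)).2 (hψ2 u), ?_, fun u hu => ?_⟩
  · refine ⟨hanti.measurable.aestronglyMeasurable, ?_⟩
    rw [hasFiniteIntegral_iff_ofReal (Eventually.of_forall fun u =>
      (div_pos two_pos (hψpos u)).le)]
    have heq : ∫⁻ u in Ioi (0 : ℝ), ENNReal.ofReal (2 / ψ u)
        = ∫⁻ u in Ioi (0 : ℝ), 2 * (genInv φ (ENNReal.ofReal (c * Real.exp u)))⁻¹ := by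
      refine setLIntegral_congr_fun measurableSet_Ioi fun u hu => ?_
      have hmax : max u 0 = u := max_eq_left (le_of_lt hu)
      have := hfin u
      have hp := hψpos u
      simp only [hψ, hmax] at this hp ⊢
      rw [ENNReal.ofReal_div_of_pos hp, ENNReal.ofReal_toReal this, ENNReal.ofReal_ofNat, div_eq_mul_inv]
    rw [heq, lintegral_const_mul' _ _ (by simp)]
    exact ENNReal.mul_lt_top (by simp) hconvc.lt_top
  · have hmax : max u 0 = u := max_eq_left hu.le
    have hf := hfin u
    have hp := hψpos u
    refine (apply_lt_of_lt_genInv ?_).le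
    rw [← hmax, ← ENNReal.ofReal_toReal hf, hmax]
    refine (ENNReal.ofReal_lt_ofReal_iff ?_).2 ?_
    · simpa only [hψ, hmax] using hp
    · simp only [hψ, hmax] at hp ⊢
      rw [inv_div]
      linarith

end Growth

/-- Let `φ : [0,∞] → [0,∞]` be non-decreasing with `φ(t) ≥ C·t` for
all `t ∈ [T,∞]` (some `C > 0`, `T ∈ (0,∞)`) and `∫_{δ*}^∞ dτ/(τ φ⁻¹(τ)) < ∞` for some
`δ* ∈ (φ(0),∞)`.  Then for every `n ≥ 2` there are `R > 1` and a `C¹` diffeomorphism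
`f` of the punctured unit ball `𝔹ⁿ \ {0}` onto the ring `{1 < |x| < R}` (injective,
with the stated image, `C¹` with everywhere non-degenerate derivative, and with `C¹`
inverse) such that `∫_{𝔹ⁿ\{0}} φ(K_O(x,f)) dm(x) < ∞`, where
`K_O(x,f) = ‖f′(x)‖ⁿ/|det f′(x)|`, but `f` has no limit at `0`. -/
theorem stmt_13 (φ : ℝ≥0∞ → ℝ≥0∞) (hφmono : Monotone φ)
    (C T : ℝ) (hC : 0 < C) (hT : 0 < T)
    (hgrowth : ∀ t : ℝ≥0∞, ENNReal.ofReal T ≤ t → ENNReal.ofReal C * t ≤ φ t)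
    (δs : ℝ) (hδs : φ 0 < ENNReal.ofReal δs)
    (hconv : ∫⁻ τ in Set.Ioi δs,
      (ENNReal.ofReal τ * genInv φ (ENNReal.ofReal τ))⁻¹ ≠ ∞)
    (n : ℕ) (hn : 2 ≤ n) :
    ∃ R : ℝ, 1 < R ∧
      ∃ f : EuclideanSpace ℝ (Fin n) → EuclideanSpace ℝ (Fin n),
        Set.InjOn f (Metric.ball (0 : EuclideanSpace ℝ (Fin n)) 1 \ {0}) ∧
        f '' (Metric.ball (0 : EuclideanSpace ℝ (Fin n)) 1 \ {0}) =
          {y : EuclideanSpace ℝ (Fin n) | 1 < ‖y‖ ∧ ‖y‖ < R} ∧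
        ContDiffOn ℝ 1 f (Metric.ball (0 : EuclideanSpace ℝ (Fin n)) 1 \ {0}) ∧
        ContDiffOn ℝ 1
          (Function.invFunOn f (Metric.ball (0 : EuclideanSpace ℝ (Fin n)) 1 \ {0}))
          {y : EuclideanSpace ℝ (Fin n) | 1 < ‖y‖ ∧ ‖y‖ < R} ∧
        (∀ x ∈ Metric.ball (0 : EuclideanSpace ℝ (Fin n)) 1 \ {0},
          DifferentiableAt ℝ f x ∧ (fderiv ℝ f x).det ≠ 0) ∧
        (∫⁻ x in Metric.ball (0 : EuclideanSpace ℝ (Fin n)) 1 \ {0},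
          φ (ENNReal.ofReal (‖fderiv ℝ f x‖ ^ n / |(fderiv ℝ f x).det|))) ≠ ∞ ∧
        ¬ ∃ L : EuclideanSpace ℝ (Fin n),
            Tendsto f (𝓝[Metric.ball (0 : EuclideanSpace ℝ (Fin n)) 1 \ {0}] 0) (𝓝 L) := by
  have hδ : 0 < δs := ENNReal.ofReal_pos.1 (bot_le.trans_lt hδs)
  obtain ⟨c, g, hc, hganti, hgpos, hgle, hgint, hgφ⟩ :=
    exists_antitone_integrable hC hgrowth hδ hconv
  obtain ⟨E, lam, hlamc, hE, hglam, hlam1, hE0⟩ :=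
    exists_primitive_of_antitone hganti hgpos hgle hgint
  have hlam0 : ∀ u, 0 < lam u := fun u => (hgpos u).trans_le (hglam u)
  have hEderiv : deriv E = fun u => -lam u := funext fun u => (hE u).deriv
  have hEdiff : Differentiable ℝ E := fun u => (hE u).differentiableAt
  have hEanti : StrictAnti E := strictAnti_of_deriv_neg fun u => by
    rw [hEderiv]
    exact neg_neg_of_pos (hlam0 u)
  have hEC : ContDiff ℝ 1 E := by
    rw [contDiff_one_iff_deriv, hEderiv]
    exact ⟨hEdiff, hlamc.neg⟩
  have hEnonneg : ∀ u, 0 ≤ E u := hEanti.antitone.le_of_tendsto hE0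
  have hR : 1 < Real.exp (E 0) :=
    Real.one_lt_exp_iff.2 ((hEnonneg 1).trans_lt (hEanti one_pos))
  have hfin : Module.finrank ℝ (EuclideanSpace ℝ (Fin n)) = n := finrank_euclideanSpace_fin
  have : Nontrivial (EuclideanSpace ℝ (Fin n)) :=
    Module.nontrivial_of_finrank_pos (R := ℝ) (by omega)
  have hopen : IsOpen (ball (0 : EuclideanSpace ℝ (Fin n)) 1 \ {0}) :=
    isOpen_ball.sdiff isClosed_singleton
  have hinj : InjOn (radialMap E) (ball (0 : EuclideanSpace ℝ (Fin n)) 1 \ {0}) :=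
    (injOn_radialMap hEanti).mono fun x hx => hx.2
  have himg := image_radialMap (V := EuclideanSpace ℝ (Fin n)) hEanti hEC.continuous hE0
  have hCD : ContDiffOn ℝ 1 (radialMap E) (ball (0 : EuclideanSpace ℝ (Fin n)) 1 \ {0}) :=
    fun x hx => (contDiffAt_radialMap hEC hx.2).contDiffWithinAt
  have hdet : ∀ x ∈ ball (0 : EuclideanSpace ℝ (Fin n)) 1 \ {0},
      (fderiv ℝ (radialMap E) x).det ≠ 0 := fun x hx => by
    rw [(hasFDerivAt_radialMap hE hx.2).fderiv, det_smul_lineStretch _ _ hx.2]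
    exact mul_ne_zero (pow_ne_zero _ (Real.exp_ne_zero _)) (hlam0 _).ne'
  refine ⟨Real.exp (E 0), hR, radialMap E, hinj, himg, hCD, ?_,
    fun x hx => ⟨(hasFDerivAt_radialMap hE hx.2).differentiableAt, hdet x hx⟩, ?_,
    not_tendsto_radialMap hEnonneg⟩
  · rw [← himg]
    exact contDiffOn_invFunOn hopen hinj hCD hdet
  · have hball := lintegral_ball_inv_norm_ne_top
      (volume : Measure (EuclideanSpace ℝ (Fin n))) (by omega)
    refine ne_top_of_le_ne_top (ENNReal.mul_ne_top (ENNReal.ofReal_ne_top (r := c)) hball) ?_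
    rw [← lintegral_const_mul' _ _ ENNReal.ofReal_ne_top]
    refine (setLIntegral_mono' hopen.measurableSet fun x hx => ?_).trans
      (lintegral_mono_set sdiff_subset)
    have hx0 : 0 < ‖x‖ := norm_pos_iff.2 hx.2
    have hu : 0 < -Real.log ‖x‖ := neg_pos.2 (Real.log_neg hx0 (mem_ball_zero_iff.1 hx.1))
    have hK := outerDilatation_radialMap_le hE hlam0 hlam1 hx.2
    rw [hfin] at hK
    calc _ ≤ φ (ENNReal.ofReal (g (-Real.log ‖x‖))⁻¹) :=
          hφmono (ENNReal.ofReal_le_ofReal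
            (hK.trans (inv_anti₀ (hgpos _) (hglam _))))
      _ ≤ _ := hgφ _ hu
      _ = _ := by rw [Real.exp_neg, Real.exp_log hx0, ENNReal.ofReal_mul hc.le]
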